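/- There is a universal constant c > 0 such that the following holds. Let I be a GCMP instance with k robots. In any schedule opt(I) for I of minimum total traveled length, every robot R ∈ F whose starting vertex is at distance λ from a nice vertex has traveled length at most c·(λ·k + k⁴). -/

import Mathlib

open SimpleGraph

/-- A GCMP instance on a graph `G` with `k` robots: `isM i` holds iff robot `i` belongs
to the set `M` of robots with destinations (otherwise it is a free robot of `F`);
`start` gives the starting vertices (pairwise distinct), and `dest` gives the
destination vertices of the robots in `M` (pairwise distinct on `M`). -/
structure Inst (V : Type) (G : SimpleGraph V) (k : ℕ) where
  isM : Fin k → Prop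
  start : Fin k → V
  dest : Fin k → V
  start_inj : Function.Injective start
  dest_injOn : Set.InjOn dest {i | isM i}

/-- A schedule for a GCMP instance: positions `pos j i` of robot `i` at time `j ∈ [0,T]`,
each robot follows a route (stay or move along an edge), starting at its starting vertex,
robots of `M` ending at their destinations, and the routes are pairwise non-conflicting
(no two robots on the same vertex at the same time, and no edge swap). -/
structure Sched {V : Type} {G : SimpleGraph V} {k : ℕ} (I : Inst V G k) where
  T : ℕ
  pos : ℕ → Fin k → V
  init : ∀ i, pos 0 i = I.start i
  final : ∀ i, I.isM i → pos T i = I.dest i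
  step : ∀ j, j < T → ∀ i, pos (j + 1) i = pos j i ∨ G.Adj (pos j i) (pos (j + 1) i)
  noVertexConflict : ∀ j, j ≤ T → Function.Injective fun i => pos j i
  noSwap : ∀ j, j < T → ∀ i i', i ≠ i' →
      ¬(pos (j + 1) i = pos j i' ∧ pos (j + 1) i' = pos j i)

/-- The (traveled) length of the route of robot `i` in schedule `S`:
the number of time steps at which robot `i` moves. -/
noncomputable def routeLength {V : Type} {G : SimpleGraph V} {k : ℕ} {I : Inst V G k}
    (S : Sched I) (i : Fin k) : ℕ :=
  {j : ℕ | j < S.T ∧ S.pos j i ≠ S.pos (j + 1) i}.ncard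

/-- The total traveled length (energy) of a schedule. -/
noncomputable def totalLength {V : Type} {G : SimpleGraph V} {k : ℕ} {I : Inst V G k}
    (S : Sched I) : ℕ :=
  ∑ i : Fin k, routeLength S i

/-- A schedule is optimal if it has minimum total traveled length. -/
def Optimal {V : Type} {G : SimpleGraph V} {k : ℕ} {I : Inst V G k}
    (S : Sched I) : Prop :=
  ∀ S' : Sched I, totalLength S ≤ totalLength S'

/-- A vertex `w` of `G` is *nice* with respect to `k` if there are three connected
subgraphs `C1, C2, C3` of `G` whose vertex sets pairwise intersect exactly in `{w}`,
with `|V(C1)| ≥ k+1`, `|V(C2)| ≥ k+1` and `|V(C3)| ≥ 2`. -/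
def IsNice {V : Type} (G : SimpleGraph V) (k : ℕ) (w : V) : Prop :=
  ∃ C1 C2 C3 : G.Subgraph,
    C1.Connected ∧ C2.Connected ∧ C3.Connected ∧
    C1.verts ∩ C2.verts = {w} ∧ C1.verts ∩ C3.verts = {w} ∧ C2.verts ∩ C3.verts = {w} ∧
    k + 1 ≤ C1.verts.ncard ∧ k + 1 ≤ C2.verts.ncard ∧ 2 ≤ C3.verts.ncard

/-- `H` is the haven of the nice vertex `w` built from the witnessing connected subgraphs
`C1, C2, C3` and a neighbor `x` of `w` lying in `C3`: it consists of those vertices of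
`{x} ∪ V(C1) ∪ V(C2)` whose distance from `w` within (the subgraph induced by)
`{x} ∪ V(C1) ∪ V(C2)` is at most `k`. -/
def IsHavenWith {V : Type} (G : SimpleGraph V) (k : ℕ) (w : V)
    (C1 C2 C3 : G.Subgraph) (x : V) (H : Set V) : Prop :=
  C1.Connected ∧ C2.Connected ∧ C3.Connected ∧
  C1.verts ∩ C2.verts = {w} ∧ C1.verts ∩ C3.verts = {w} ∧ C2.verts ∩ C3.verts = {w} ∧
  k + 1 ≤ C1.verts.ncard ∧ k + 1 ≤ C2.verts.ncard ∧ 2 ≤ C3.verts.ncard ∧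
  x ∈ C3.verts ∧ G.Adj w x ∧
  ∃ hw : w ∈ ({x} ∪ C1.verts ∪ C2.verts : Set V),
    H = {u : V | ∃ hu : u ∈ ({x} ∪ C1.verts ∪ C2.verts : Set V),
          (G.induce ({x} ∪ C1.verts ∪ C2.verts : Set V)).dist ⟨w, hw⟩ ⟨u, hu⟩ ≤ k}

/-- `H` is a haven for `w` (for some choice of witnesses). -/
def IsHaven {V : Type} (G : SimpleGraph V) (k : ℕ) (w : V) (H : Set V) : Prop :=
  ∃ (C1 C2 C3 : G.Subgraph) (x : V), IsHavenWith G k w C1 C2 C3 x H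

/-! ## Configurations and reachability with cost -/

open Classical in
noncomputable def mv {V : Type} {k : ℕ} (a b : Fin k → V) : ℕ :=
  ∑ i, if a i ≠ b i then 1 else 0

def CStep {V : Type} (G : SimpleGraph V) {k : ℕ} (a b : Fin k → V) : Prop :=
  Function.Injective a ∧ Function.Injective b ∧ (∀ i, b i = a i ∨ G.Adj (a i) (b i)) ∧
  ∀ i i', i ≠ i' → ¬ (b i = a i' ∧ b i' = a i)

inductive Reach {V : Type} (G : SimpleGraph V) {k : ℕ} : (Fin k → V) → (Fin k → V) → ℕ → Prop
  | refl (a : Fin k → V) (c : ℕ) : Reach G a a c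
  | tail {a b d : Fin k → V} {c c' : ℕ} : Reach G a b c → CStep G b d → c + mv b d ≤ c' →
      Reach G a d c'

section basics
variable {V : Type} {G : SimpleGraph V} {k : ℕ}

lemma Reach.mono {a b : Fin k → V} {c c' : ℕ} (h : Reach G a b c) (hc : c ≤ c') :
    Reach G a b c' := by
  cases h with
  | refl => exact .refl _ _
  | tail h1 h2 h3 => exact .tail h1 h2 (h3.trans hc)

lemma Reach.trans {a b d : Fin k → V} {c c' : ℕ} (h : Reach G a b c) (h' : Reach G b d c') :
    Reach G a d (c + c') := by
  induction h' with
  | refl => exact h.mono (by omega)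
  | tail h1 h2 h3 ih => exact .tail ih h2 (by omega)

lemma Reach.inj {a b : Fin k → V} {c : ℕ} (h : Reach G a b c) (ha : Function.Injective a) :
    Function.Injective b := by
  cases h with
  | refl => exact ha
  | tail h1 h2 h3 => exact h2.2.1

lemma mv_comm (a b : Fin k → V) : mv a b = mv b a := by
  unfold mv; exact Finset.sum_congr rfl fun i _ => by
    by_cases h : a i = b i
    · simp [h]
    · simp [h, Ne.symm h]

lemma CStep.symm {a b : Fin k → V} (h : CStep G a b) : CStep G b a := by
  obtain ⟨h1, h2, h3, h4⟩ := h
  refine ⟨h2, h1, fun i => (h3 i).imp Eq.symm SimpleGraph.Adj.symm, fun i i' hi hh => h4 i i' hi ?_⟩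
  exact ⟨hh.2.symm, hh.1.symm⟩

lemma Reach.symm {a b : Fin k → V} {c : ℕ} (h : Reach G a b c) : Reach G b a c := by
  induction h with
  | refl => exact .refl _ _
  | @tail b d c c' h1 h2 h3 ih =>
    have : Reach G d b (mv b d) := .tail (.refl d 0) h2.symm (by rw [mv_comm]; omega)
    exact (this.trans ih).mono (by omega)

lemma Reach.move {q : Fin k → V} (hq : Function.Injective q) {r : Fin k} {u : V}
    (hadj : G.Adj (q r) u) (hu : ∀ j, q j ≠ u) : Reach G q (Function.update q r u) 1 := by
  classical
  refine .tail (.refl q 0) ⟨hq, ?_, ?_, ?_⟩ ?_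
  · intro a b hab
    by_cases ha : a = r <;> by_cases hb : b = r
    · rw [ha, hb]
    · subst ha; simp [hb] at hab; exact absurd hab.symm (hu b)
    · subst hb; simp [ha] at hab; exact absurd hab (hu a)
    · simp [ha, hb] at hab; exact hq hab
  · intro a
    by_cases ha : a = r
    · subst ha; simp [hadj]
    · simp [ha]
  · rintro a b hab ⟨h1, h2⟩
    by_cases ha : a = r
    · subst ha; simp at h1; exact hu b h1.symm
    · simp [ha] at h1; exact hab (hq h1)
  · unfold mv
    rw [zero_add]
    refine (Finset.sum_le_sum (g := fun i => if i = r then 1 else 0) ?_).trans (by simp)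
    intro a _
    by_cases ha : a = r
    · simp [ha]; split <;> omega
    · simp [ha]

lemma update_inj {q : Fin k → V} (hq : Function.Injective q) {r : Fin k} {u : V}
    (hu : ∀ j, j ≠ r → q j ≠ u) : Function.Injective (Function.update q r u) := by
  intro a b hab
  by_cases ha : a = r <;> by_cases hb : b = r
  · rw [ha, hb]
  · subst ha; simp [hb] at hab; exact absurd hab.symm (hu b hb)
  · subst hb; simp [ha] at hab; exact absurd hab (hu a ha)
  · simp [ha, hb] at hab; exact hq hab

lemma Reach.walk {v u : V} (p : G.Walk v u) : ∀ {q : Fin k → V} (_ : Function.Injective q)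
    {r : Fin k} (_ : q r = v) (_ : ∀ x ∈ p.support, ∀ j, j ≠ r → q j ≠ x),
    Reach G q (Function.update q r u) p.length := by
  induction p with
  | nil => intro q hq r hr _; rw [← hr]; simp; exact .refl _ _
  | @cons a b c h p ih =>
    intro q hq r hr hs
    have hb : ∀ j, q j ≠ b := by
      intro j hj
      by_cases hjr : j = r
      · subst hjr; rw [hr] at hj; exact h.ne hj
      · exact hs b (by simp) j hjr hj
    have h1 := Reach.move hq (r := r) (u := b) (by rw [hr]; exact h) hb
    have h2 := ih (q := Function.update q r b) (h1.inj hq) (r := r) (by simp) (by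
      intro x hx j hj
      simp [hj]
      exact hs x (by simp [hx]) j hj)
    have := h1.trans h2
    simp at this
    exact this.mono (by simp; omega)

lemma Reach.shift {u y : V} (p : G.Walk u y) : ∀ {q : Fin k → V} (_ : Function.Injective q)
    {r : Fin k} (_ : q r = u) (_ : ∀ j, q j ≠ y),
    ∃ q', Reach G q q' p.length ∧ Set.range q' = insert y (Set.range q \ {u}) ∧
      (∀ j, q j ∉ p.support → q' j = q j) ∧ (∀ j, q j ∈ p.support → q' j ∈ p.support) := by
  induction p with
  | nil => intro q hq r hr hy; exact absurd hr (hy r)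
  | @cons a b c h p ih =>
    intro q hq r hr hy
    have hrange : ∀ (q : Fin k → V), Function.Injective q → q r = a → 
        Set.range (Function.update q r b) = insert b (Set.range q \ {a}) := by
      intro q hq hr
      ext z
      simp only [Set.mem_range, Set.mem_insert_iff, Set.mem_sdiff, Set.mem_singleton_iff]
      constructor
      · rintro ⟨j, hj⟩
        by_cases hjr : j = r
        · subst hjr; simp at hj; exact Or.inl hj.symm
        · simp [hjr] at hj
          refine Or.inr ⟨⟨j, hj⟩, ?_⟩
          rintro rfl
          exact hjr (hq (hj.trans hr.symm))
      · rintro (rfl | ⟨⟨j, rfl⟩, hz⟩)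
        · exact ⟨r, by simp⟩
        · refine ⟨j, ?_⟩
          have : j ≠ r := by rintro rfl; exact hz hr
          simp [this]
    by_cases hb : ∃ j, q j = b
    · obtain ⟨s, hs⟩ := hb
      obtain ⟨q', h1, h2, h3, h4⟩ := ih hq hs hy
      have hab : a ≠ b := h.ne
      have hac : a ≠ c := fun hh => hy r (hr.trans hh)
      have hbc : b ≠ c := fun hh => hy s (hs.trans hh)
      have hbn : ∀ j, q' j ≠ b := by
        intro j hj
        have : b ∈ Set.range q' := ⟨j, hj⟩
        rw [h2] at this
        simp [hbc] at this
      have : a ∈ Set.range q' := by rw [h2]; simp [hac, hab]; exact ⟨r, hr⟩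
      obtain ⟨t, ht⟩ := this
      have hq' := h1.inj hq
      have h5 := Reach.move hq' (r := t) (u := b) (by rw [ht]; exact h) hbn
      refine ⟨_, (h1.trans h5).mono (by simp), ?_, ?_, ?_⟩
      · ext z
        simp only [Set.mem_range, Set.mem_insert_iff, Set.mem_sdiff, Set.mem_singleton_iff]
        have h2z : ∀ z, (∃ j, q' j = z) ↔ z = c ∨ (∃ j, q j = z) ∧ z ≠ b := by
          intro z
          have := Set.ext_iff.1 h2 z
          simpa using this
        constructor
        · rintro ⟨j, hj⟩
          by_cases hjr : j = t
          · subst hjr; simp at hj; subst hj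
            exact Or.inr ⟨⟨s, hs⟩, hab.symm⟩
          · simp [hjr] at hj
            have hza : z ≠ a := by rintro rfl; exact hjr (hq' (hj.trans ht.symm))
            rcases (h2z z).1 ⟨j, hj⟩ with h | h
            · exact Or.inl h
            · exact Or.inr ⟨h.1, hza⟩
        · intro hz
          by_cases hzb : z = b
          · exact ⟨t, by simp [hzb]⟩
          · have : ∃ j, q' j = z := (h2z z).2 (by tauto)
            obtain ⟨j, hj⟩ := this
            refine ⟨j, ?_⟩
            have : j ≠ t := by
              rintro rfl
              have hza : z = a := hj.symm.trans ht
              rcases hz with hz | hz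
              · exact hac (hza.symm.trans hz)
              · exact hz.2 hza
            simp [this, hj]
      · intro j hj
        simp at hj
        have : q' j = q j := h3 j hj.2
        have hjt : j ≠ t := by rintro rfl; exact hj.1 (this.symm.trans ht)
        simp [hjt, this]
      · intro j hj
        by_cases hjt : j = t
        · simp [hjt]
        · simp [hjt]
          by_cases hjp : q j ∈ p.support
          · exact Or.inr (h4 j hjp)
          · rw [h3 j hjp]; simpa using hj
    · push Not at hb
      have h1 := Reach.move hq (r := r) (u := b) (by rw [hr]; exact h) hb
      have hr1 := hrange q hq hr
      by_cases hbc : b = c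
      · subst hbc
        refine ⟨_, h1.mono (by simp), hr1, ?_, ?_⟩
        · intro j hj
          simp at hj
          have hjt : j ≠ r := by rintro rfl; exact hj.1 hr
          simp [hjt]
        · intro j hj
          by_cases hjt : j = r
          · simp [hjt]
          · simpa [hjt] using hj
      · obtain ⟨q', h5, h2, h3, h4⟩ := ih (h1.inj hq) (r := r) (by simp) (by
          intro j
          by_cases hjt : j = r
          · simpa [hjt] using hbc
          · simpa [hjt] using hy j)
        refine ⟨q', (h1.trans h5).mono (by simp; omega), ?_, ?_, ?_⟩
        · rw [h2, hr1]
          congr 1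
          ext z
          simp only [Set.mem_range, Set.mem_insert_iff, Set.mem_sdiff, Set.mem_singleton_iff]
          constructor
          · rintro ⟨h | h, h'⟩
            · exact absurd h h'
            · exact h
          · intro hh
            refine ⟨Or.inr hh, ?_⟩
            rintro rfl
            obtain ⟨j, hj⟩ := hh.1
            exact hb j hj
        · intro j hj
          simp at hj
          have hjt : j ≠ r := by rintro rfl; exact hj.1 hr
          have := h3 j (by simpa [hjt] using hj.2)
          simpa [hjt] using this
        · intro j hj
          by_cases hjt : j = r
          · have := h4 j (by simp [hjt])
            simp [this]
          · by_cases hjp : q j ∈ p.support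
            · have := h4 j (by simpa [hjt] using hjp)
              simp [this]
            · have := h3 j (by simpa [hjt] using hjp)
              rw [this]
              simpa [hjt] using hj

/-- `U` is star-connected to `w` with radius `L`. -/
def StarC (G : SimpleGraph V) (w : V) (L : ℕ) (U : Set V) : Prop :=
  ∀ a ∈ U, ∃ p : G.Walk a w, p.length ≤ L ∧ ∀ v ∈ p.support, v ∈ U

lemma StarC.union {w : V} {L : ℕ} {U W : Set V} (h : StarC G w L U) (h' : StarC G w L W) :
    StarC G w L (U ∪ W) := by
  rintro a (ha | ha)
  · obtain ⟨p, h1, h2⟩ := h a ha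
    exact ⟨p, h1, fun v hv => Or.inl (h2 v hv)⟩
  · obtain ⟨p, h1, h2⟩ := h' a ha
    exact ⟨p, h1, fun v hv => Or.inr (h2 v hv)⟩

lemma Reach.gather {w : V} {L : ℕ} {U : Set V} (hU : StarC G w L U) (Y : Finset V)
    (hY : ∀ y ∈ Y, y ∈ U) (n : ℕ) : ∀ {q : Fin k → V} (_ : Function.Injective q)
    (_ : {j | q j ∈ U}.ncard ≤ Y.card) (_ : (Set.range q ∩ (U \ ↑Y)).ncard ≤ n),
    ∃ q', Reach G q q' (n * (2 * L)) ∧ (∀ j, q j ∉ U → q' j = q j) ∧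
      (∀ j, q j ∈ U → q' j ∈ Y) := by
  induction n with
  | zero =>
    intro q hq hc hn
    refine ⟨q, .refl _ _, fun _ _ => rfl, fun j hj => ?_⟩
    by_contra hjY
    have h0 : Set.range q ∩ (U \ ↑Y) = ∅ := by
      rw [← Set.ncard_eq_zero (((Set.finite_range q)).inter_of_left _)]; omega
    have : q j ∈ Set.range q ∩ (U \ ↑Y) := ⟨⟨j, rfl⟩, hj, by simpa using hjY⟩
    rw [h0] at this
    exact this
  | succ n ih =>
    intro q hq hc hn
    by_cases hall : ∀ j, q j ∈ U → q j ∈ Y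
    · exact ⟨q, .refl _ _, fun _ _ => rfl, hall⟩
    push Not at hall
    obtain ⟨r, hrU, hrY⟩ := hall
    have hy : ∃ y ∈ Y, ∀ j, q j ≠ y := by
      by_contra hcon
      push Not at hcon
      classical
      have hsub : ((insert (q r) Y : Finset V) : Set V) ⊆ q '' {j | q j ∈ U} := by
        intro z hz
        simp at hz
        rcases hz with rfl | hz
        · exact ⟨r, hrU, rfl⟩
        · obtain ⟨j, hj⟩ := hcon z hz
          exact ⟨j, by simp [hj, hY z hz], hj⟩
      have h1 := Set.ncard_le_ncard hsub (Set.toFinite _)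
      rw [Set.ncard_coe_finset, Finset.card_insert_of_notMem hrY] at h1
      have h2 := Set.ncard_image_le (f := q) (Set.toFinite {j | q j ∈ U})
      omega
    obtain ⟨y, hyY, hyq⟩ := hy
    obtain ⟨p1, hp1, hs1⟩ := hU _ hrU
    obtain ⟨p2, hp2, hs2⟩ := hU _ (hY y hyY)
    obtain ⟨q1, h1, h2, h3, h4⟩ := Reach.shift (p1.append p2.reverse) hq rfl hyq
    have hsU : ∀ v ∈ (p1.append p2.reverse).support, v ∈ U := by
      intro v hv
      rw [SimpleGraph.Walk.mem_support_append_iff] at hv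
      rcases hv with hv | hv
      · exact hs1 v hv
      · exact hs2 v (by simpa using hv)
    have hout : ∀ j, q j ∉ U → q1 j = q j := fun j hj => h3 j (fun h => hj (hsU _ h))
    have hin : ∀ j, q j ∈ U → q1 j ∈ U := by
      intro j hj
      by_cases hjs : q j ∈ (p1.append p2.reverse).support
      · exact hsU _ (h4 j hjs)
      · rw [h3 j hjs]; exact hj
    have hiff : {j | q1 j ∈ U} = {j | q j ∈ U} := by
      ext j
      simp only [Set.mem_ofPred_eq]
      refine ⟨fun h => ?_, hin j⟩
      by_contra hj
      rw [hout j hj] at h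
      exact hj h
    obtain ⟨q2, h5, h6, h7⟩ := ih (h1.inj hq) (by rw [hiff]; exact hc) (by
      have hsub : Set.range q1 ∩ (U \ ↑Y) ⊆ (Set.range q ∩ (U \ ↑Y)) \ {q r} := by
        rw [h2]
        rintro z ⟨hz1, hz2, hz3⟩
        rcases hz1 with rfl | hz1
        · exact absurd hyY hz3
        · exact ⟨⟨hz1.1, hz2, hz3⟩, hz1.2⟩
      have hfin := (Set.finite_range q).inter_of_left (U \ ↑Y)
      have e1 := Set.ncard_le_ncard hsub (hfin.subset Set.sdiff_subset)
      have e2 := Set.ncard_sdiff_singleton_add_one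
        (show q r ∈ Set.range q ∩ (U \ ↑Y) from ⟨⟨r, rfl⟩, hrU, by simpa using hrY⟩) hfin
      omega)
    refine ⟨q2, (h1.trans h5).mono ?_, ?_, ?_⟩
    · simp; nlinarith
    · intro j hj
      rw [← hout j hj]
      apply h6; rw [hout j hj]; exact hj
    · intro j hj
      exact h7 j (hin j hj)

lemma Reach.gather' {w : V} {L : ℕ} {U : Set V} (hU : StarC G w L U) (Y : Finset V)
    (hY : ∀ y ∈ Y, y ∈ U) {q : Fin k → V} (hq : Function.Injective q)
    (hc : {j | q j ∈ U}.ncard ≤ Y.card) :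
    ∃ q', Reach G q q' (k * (2 * L)) ∧ (∀ j, q j ∉ U → q' j = q j) ∧
      (∀ j, q j ∈ U → q' j ∈ Y) := by
  refine Reach.gather hU Y hY k hq hc ?_
  refine (Set.ncard_le_ncard Set.inter_subset_left (Set.finite_range q)).trans ?_
  rw [← Set.image_univ]
  refine (Set.ncard_image_le Set.finite_univ).trans ?_
  simp [Set.ncard_univ]

end basics

/-! ## Havens -/

structure Hav {V : Type} (G : SimpleGraph V) (k : ℕ) (w x : V) (α β : ℕ → V) : Prop where
  a0 : α 0 = w
  b0 : β 0 = w
  adj : G.Adj w x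
  apar : ∀ p, 1 ≤ p → p ≤ k → ∃ q < p, G.Adj (α q) (α p)
  bpar : ∀ p, 1 ≤ p → p ≤ k → ∃ q < p, G.Adj (β q) (β p)
  ainj : ∀ p q, p ≤ k → q ≤ k → α p = α q → p = q
  binj : ∀ p q, p ≤ k → q ≤ k → β p = β q → p = q
  ab : ∀ p q, p ≤ k → q ≤ k → α p = β q → p = 0 ∧ q = 0
  ax : ∀ p, p ≤ k → α p ≠ x
  bx : ∀ p, p ≤ k → β p ≠ x

section haven
variable {V : Type} {G : SimpleGraph V} {k : ℕ}

lemma star_chain {α : ℕ → V} {w : V} (h0 : α 0 = w)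
    (hp : ∀ p, 1 ≤ p → p ≤ k → ∃ q < p, G.Adj (α q) (α p)) (m : ℕ) (hm : m ≤ k) :
    StarC G w k (α '' Set.Iic m) := by
  have key : ∀ p, p ≤ k → ∃ W : G.Walk (α p) w, W.length ≤ p ∧
      ∀ v ∈ W.support, v ∈ α '' Set.Iic p := by
    intro p
    induction p using Nat.strong_induction_on with
    | _ p ih =>
      intro hpk
      rcases Nat.eq_zero_or_pos p with rfl | hpos
      · subst h0
        exact ⟨.nil, by simp, by simp⟩
      · obtain ⟨q, hq, hadj⟩ := hp p hpos hpk
        obtain ⟨W, h1, h2⟩ := ih q hq (by omega)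
        refine ⟨.cons hadj.symm W, by simp; omega, ?_⟩
        intro v hv
        simp at hv
        rcases hv with rfl | hv
        · exact ⟨p, by simp, rfl⟩
        · obtain ⟨s, hs, rfl⟩ := h2 v hv
          exact ⟨s, by simp at hs ⊢; omega, rfl⟩
  rintro a ⟨p, hpm, rfl⟩
  simp at hpm
  obtain ⟨W, h1, h2⟩ := key p (by omega)
  refine ⟨W, by omega, fun v hv => ?_⟩
  obtain ⟨s, hs, rfl⟩ := h2 v hv
  exact ⟨s, by simp at hs ⊢; omega, rfl⟩

/-- the region `H_d`. -/
def Reg (k : ℕ) (w x : V) (α β : ℕ → V) (d : ℕ) : Set V :=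
  (α '' Set.Iic d ∪ β '' Set.Iic k) ∪ {w, x}

lemma mem_Reg {w x : V} {α β : ℕ → V} {d : ℕ} {v : V} (hk : Hav G k w x α β) :
    v ∈ Reg k w x α β d ↔ (∃ p ≤ d, α p = v) ∨ (∃ p ≤ k, β p = v) ∨ v = x := by
  unfold Reg
  simp only [Set.mem_union, Set.mem_image, Set.mem_Iic, Set.mem_insert_iff,
    Set.mem_singleton_iff]
  constructor
  · rintro ((h | h) | (h | h))
    · exact Or.inl h
    · exact Or.inr (Or.inl h)
    · exact Or.inl ⟨0, by omega, by rw [hk.a0, h]⟩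
    · exact Or.inr (Or.inr h)
  · rintro (h | h | h)
    · exact Or.inl (Or.inl h)
    · exact Or.inl (Or.inr h)
    · exact Or.inr (Or.inr h)

lemma sort_step {w x : V} {α β : ℕ → V} (hk : Hav G k w x α β) (d : ℕ) (hd : d < k)
    {q : Fin k → V} (hq : Function.Injective q)
    (hinv : ∀ j : Fin k, q j ∈ Reg k w x α β k →
      (d + 1 ≤ j → q j = α (j + 1)) ∧ ((j : ℕ) < d + 1 → q j ∈ Reg k w x α β (d + 1))) :
    ∃ q', Reach G q q' (6 * k ^ 2 + 2 * k + 2) ∧ (∀ j, q j ∉ Reg k w x α β k → q' j = q j) ∧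
      ∀ j : Fin k, q j ∈ Reg k w x α β k →
      (d ≤ j → q' j = α (j + 1)) ∧ ((j : ℕ) < d → q' j ∈ Reg k w x α β d) := by
  classical
  set U := Reg k w x α β (d + 1) with hU
  have hUk : ∀ v ∈ U, v ∈ Reg k w x α β k := by
    intro v hv
    rw [hU, mem_Reg hk] at hv
    rw [mem_Reg hk]
    rcases hv with ⟨p, hp, h⟩ | hv
    · exact Or.inl ⟨p, by omega, h⟩
    · exact Or.inr hv
  have sA : ∀ m, m ≤ k → StarC G w k (α '' Set.Iic m) := star_chain hk.a0 hk.apar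
  have sB : ∀ m, m ≤ k → StarC G w k (β '' Set.Iic m) := star_chain hk.b0 hk.bpar
  have sX : StarC G w k {w, x} := by
    rintro a (rfl | rfl)
    · exact ⟨.nil, by simp, by simp⟩
    · exact ⟨.cons hk.adj.symm .nil, by simp; omega, by simp⟩
  have sU : StarC G w k U := ((sA (d+1) (by omega)).union (sB k le_rfl)).union sX
  set YB : Finset V := (Finset.Icc 1 k).image β with hYB
  set YA : Finset V := (Finset.Icc 1 (d+1)).image α with hYA
  have memYB : ∀ v, v ∈ YB ↔ ∃ p, (1 ≤ p ∧ p ≤ k) ∧ β p = v := by simp [hYB]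
  have memYA : ∀ v, v ∈ YA ↔ ∃ p, (1 ≤ p ∧ p ≤ d + 1) ∧ α p = v := by simp [hYA]
  have cYB : YB.card = k := by
    rw [hYB, Finset.card_image_of_injOn, Nat.card_Icc]; · omega
    intro a ha b hb hab
    simp at ha hb
    exact hk.binj a b ha.2 hb.2 hab
  have cYA : YA.card = d + 1 := by
    rw [hYA, Finset.card_image_of_injOn, Nat.card_Icc]; · omega
    intro a ha b hb hab
    simp at ha hb
    exact hk.ainj a b (by omega) (by omega) hab
  have hidx : ∀ j : Fin k, q j ∈ U → (j : ℕ) ≤ d := by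
    intro j hj
    by_contra hlt
    have h1 := (hinv j (hUk _ hj)).1 (by omega)
    rw [hU, mem_Reg hk, h1] at hj
    have := j.2
    rcases hj with ⟨p, hp, h⟩ | ⟨p, hp, h⟩ | h
    · have := hk.ainj _ _ (by omega) (by omega) h; omega
    · have := hk.ab _ _ (by omega) (by omega) h.symm; omega
    · exact hk.ax _ (by omega) h
  have cnt : ∀ s : Set (Fin k), (∀ j ∈ s, (j : ℕ) ≤ d) → s.ncard ≤ d + 1 := by
    intro s hs
    have h1 : ((fun j : Fin k => (j : ℕ)) '' s) ⊆ (Finset.range (d+1) : Set ℕ) := by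
      rintro _ ⟨j, hj, rfl⟩
      simp; have := hs j hj; omega
    have h2 := Set.ncard_le_ncard h1 (Finset.finite_toSet _)
    rw [Set.ncard_image_of_injective _ Fin.val_injective, Set.ncard_coe_finset] at h2
    simpa using h2
  have YBU : ∀ y ∈ YB, y ∈ U := by
    intro y hy
    obtain ⟨p, hp, h⟩ := (memYB y).1 hy
    rw [hU, mem_Reg hk]
    exact Or.inr (Or.inl ⟨p, hp.2, h⟩)
  have YBd : ∀ y ∈ YB, y ∈ Reg k w x α β d := by
    intro y hy
    obtain ⟨p, hp, h⟩ := (memYB y).1 hy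
    rw [mem_Reg hk]
    exact Or.inr (Or.inl ⟨p, hp.2, h⟩)
  have hHU : ∀ j : Fin k, q j ∈ Reg k w x α β k → q j ∉ U → d + 1 ≤ (j : ℕ) := by
    intro j h1 h2
    by_contra hlt
    exact h2 ((hinv j h1).2 (by omega))
  obtain ⟨q1, r1, o1, i1⟩ := Reach.gather' sU YB YBU hq
    (by rw [cYB]; exact (cnt _ hidx).trans (by omega))
  have hq1 := r1.inj hq
  set r : Fin k := ⟨d, hd⟩ with hr
  by_cases hrU : q r ∈ U
  swap
  · refine ⟨q1, r1.mono (by nlinarith), fun j hj => o1 j (fun h => hj (hUk _ h)), ?_⟩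
    intro j hj
    by_cases hjU : q j ∈ U
    · have := hidx j hjU
      have hne : (j : ℕ) ≠ d := by
        intro hh
        have : j = r := Fin.ext hh
        exact hrU (this ▸ hjU)
      exact ⟨fun h => by omega, fun _ => YBd _ (i1 j hjU)⟩
    · have := hHU j hj hjU
      refine ⟨fun _ => ?_, fun h => by omega⟩
      rw [o1 j hjU]; exact (hinv j hj).1 this
  -- robot `r` sits at `β p`
  obtain ⟨p, ⟨hp1, hpk⟩, hpr⟩ := (memYB _).1 (i1 r hrU)
  have sU2 : StarC G w k (β '' Set.Iic (p - 1) ∪ α '' Set.Iic (d + 1)) :=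
    (sB _ (by omega)).union (sA _ (by omega))
  have U2U : ∀ v ∈ (β '' Set.Iic (p - 1) ∪ α '' Set.Iic (d + 1)), v ∈ U := by
    rintro v (⟨s, hs, rfl⟩ | ⟨s, hs, rfl⟩) <;> rw [hU, mem_Reg hk] <;> simp at hs
    · exact Or.inr (Or.inl ⟨s, by omega, rfl⟩)
    · exact Or.inl ⟨s, by omega, rfl⟩
  have q1U : ∀ j, q1 j ∈ U → q j ∈ U := by
    intro j hj
    by_contra h
    rw [o1 j h] at hj; exact h hj
  obtain ⟨q2, r2, o2, i2⟩ := Reach.gather' sU2 YA (by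
      intro y hy
      obtain ⟨s, hs, h⟩ := (memYA y).1 hy
      exact Or.inr ⟨s, by simp; omega, h⟩) hq1
    (by rw [cYA]; exact cnt _ (fun j hj => hidx j (q1U j (U2U _ hj))))
  have hq2 := r2.inj hq1
  have hr2 : q2 r = β p := by
    rw [o2 r, hpr]
    rw [← hpr]
    rintro (⟨s, hs, h⟩ | ⟨s, hs, h⟩) <;> simp at hs
    · have := hk.binj _ _ (by omega) (by omega) h; omega
    · have := hk.ab _ _ (by omega) (by omega) h; omega
  -- other robots after stage 2
  have in2 : ∀ j, j ≠ r → q j ∈ U → (∃ s, (1 ≤ s ∧ s ≤ d + 1) ∧ α s = q2 j) ∨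
      (∃ s, (p < s ∧ s ≤ k) ∧ β s = q2 j) := by
    intro j hjr hj
    by_cases h2 : q1 j ∈ (β '' Set.Iic (p - 1) ∪ α '' Set.Iic (d + 1))
    · exact Or.inl ((memYA _).1 (i2 j h2))
    · right
      obtain ⟨s, hs, h⟩ := (memYB _).1 (i1 j hj)
      refine ⟨s, ⟨?_, hs.2⟩, by rw [o2 j h2, h]⟩
      by_contra hlt
      rcases Nat.lt_or_ge s p with h3 | h3
      · exact h2 (Or.inl ⟨s, by simp; omega, h⟩)
      · have : s = p := by omega
        subst this
        exact hjr (hq1 (h.symm.trans hpr))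
  have out2 : ∀ j, q j ∉ U → q2 j = q j := by
    intro j hj
    rw [o2 j, o1 j hj]
    rw [o1 j hj]
    exact fun h => hj (U2U _ h)
  obtain ⟨W, hW1, hW2⟩ := sB p hpk (β p) ⟨p, by simp, rfl⟩
  have r3 := Reach.walk (W.append (.cons hk.adj .nil)) hq2 hr2 (by
    intro v hv j hj hjv
    rw [SimpleGraph.Walk.mem_support_append_iff] at hv
    have hv' : (∃ s ≤ p, β s = v) ∨ v = x := by
      rcases hv with hv | hv
      · obtain ⟨s, hs, h⟩ := hW2 v hv
        exact Or.inl ⟨s, by simpa using hs, h⟩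
      · simp at hv
        rcases hv with hv | hv
        · exact Or.inl ⟨0, by omega, by rw [hk.b0, hv]⟩
        · exact Or.inr hv
    by_cases hjU : q j ∈ U
    · rcases in2 j hj hjU with ⟨s, hs, h⟩ | ⟨s, hs, h⟩ <;> rcases hv' with ⟨t, ht, h'⟩ | h'
      · have := hk.ab _ _ (by omega) (by omega) (h.trans (hjv.trans h'.symm)); omega
      · exact hk.ax s (by omega) (h.trans (hjv.trans h'))
      · have := hk.binj _ _ (by omega) (by omega) (h.trans (hjv.trans h'.symm)); omega
      · exact hk.bx s (by omega) (h.trans (hjv.trans h'))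
    · apply hjU
      rw [← out2 j hjU, hjv, hU, mem_Reg hk]
      rcases hv' with ⟨t, ht, h'⟩ | h'
      · exact Or.inr (Or.inl ⟨t, by omega, h'⟩)
      · exact Or.inr (Or.inr h'))
  set q3 := Function.update q2 r x with hq3d
  have hq3 := r3.inj hq2
  have hr3 : q3 r = x := by simp [hq3d]
  have o3 : ∀ j, j ≠ r → q3 j = q2 j := by intro j hj; simp [hq3d, hj]
  have sU3 : StarC G w k (β '' Set.Iic k ∪ α '' Set.Iic (d + 1)) :=
    (sB _ le_rfl).union (sA _ (by omega))
  have U3U : ∀ v ∈ (β '' Set.Iic k ∪ α '' Set.Iic (d + 1)), v ∈ U := by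
    rintro v (⟨s, hs, rfl⟩ | ⟨s, hs, rfl⟩) <;> rw [hU, mem_Reg hk] <;> simp at hs
    · exact Or.inr (Or.inl ⟨s, by omega, rfl⟩)
    · exact Or.inl ⟨s, by omega, rfl⟩
  have in3 : ∀ j, j ≠ r → q j ∈ U → q3 j ∈ (β '' Set.Iic k ∪ α '' Set.Iic (d + 1)) := by
    intro j hj hjU
    rw [o3 j hj]
    rcases in2 j hj hjU with ⟨s, hs, h⟩ | ⟨s, hs, h⟩
    · exact Or.inr ⟨s, by simp; omega, h⟩
    · exact Or.inl ⟨s, by simp; omega, h⟩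
  have q3U : ∀ j, q3 j ∈ U → q j ∈ U := by
    intro j hj
    by_cases hjr : j = r
    · rw [hjr]; exact hrU
    by_contra h
    rw [o3 j hjr, out2 j h] at hj; exact h hj
  obtain ⟨q4, r4, o4, i4⟩ := Reach.gather' sU3 YB (by
      intro y hy
      obtain ⟨s, hs, h⟩ := (memYB y).1 hy
      exact Or.inl ⟨s, by simp; omega, h⟩) hq3
    (by rw [cYB]; exact (cnt _ (fun j hj => hidx j (q3U j (U3U _ hj)))).trans (by omega))
  have hq4 := r4.inj hq3
  have hr4 : q4 r = x := by
    rw [o4 r, hr3]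
    rw [hr3]
    rintro (⟨s, hs, h⟩ | ⟨s, hs, h⟩) <;> simp at hs
    · exact hk.bx _ hs h
    · exact hk.ax _ (by omega) h
  have in4 : ∀ j, j ≠ r → q j ∈ U → q4 j ∈ YB := fun j hj hjU => i4 j (in3 j hj hjU)
  have out4 : ∀ j, q j ∉ U → q4 j = q j := by
    intro j hj
    have hjr : j ≠ r := by rintro rfl; exact hj hrU
    have : q3 j = q j := by rw [o3 j hjr, out2 j hj]
    rw [o4 j, this]
    rw [this]
    exact fun h => hj (U3U _ h)
  obtain ⟨W', hW1', hW2'⟩ := sA (d+1) (by omega) (α (d+1)) ⟨d+1, by simp, rfl⟩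
  have r5 := Reach.walk (SimpleGraph.Walk.cons hk.adj.symm W'.reverse) hq4 hr4 (by
    intro v hv j hj hjv
    have hv' : (∃ s ≤ d + 1, α s = v) ∨ v = x := by
      simp at hv
      rcases hv with hv | hv
      · exact Or.inr hv
      · obtain ⟨s, hs, h⟩ := hW2' v hv
        exact Or.inl ⟨s, by simpa using hs, h⟩
    by_cases hjU : q j ∈ U
    · obtain ⟨s, hs, h⟩ := (memYB _).1 (in4 j hj hjU)
      rcases hv' with ⟨t, ht, h'⟩ | h'
      · have := hk.ab _ _ (by omega) (by omega) (h'.trans (hjv.symm.trans h.symm)); omega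
      · exact hk.bx s (by omega) (h.trans (hjv.trans h'))
    · apply hjU
      rw [← out4 j hjU, hjv, hU, mem_Reg hk]
      rcases hv' with ⟨t, ht, h'⟩ | h'
      · exact Or.inl ⟨t, by omega, h'⟩
      · exact Or.inr (Or.inr h'))
  refine ⟨_, (((((r1.trans r2).trans r3).trans r4).trans r5).mono ?_), ?_, ?_⟩
  · simp only [SimpleGraph.Walk.length_append, SimpleGraph.Walk.length_cons,
      SimpleGraph.Walk.length_nil, SimpleGraph.Walk.length_reverse]
    nlinarith
  · intro j hj
    have hjr : j ≠ r := by rintro rfl; exact hj (hUk _ hrU)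
    simp only [ne_eq, hjr, not_false_eq_true, Function.update_of_ne]
    exact out4 j (fun h => hj (hUk _ h))
  · intro j hj
    by_cases hjr : j = r
    · subst hjr
      refine ⟨fun _ => by simp [hr], fun h => by simp [hr] at h⟩
    simp only [ne_eq, hjr, not_false_eq_true, Function.update_of_ne]
    by_cases hjU : q j ∈ U
    · have := hidx j hjU
      have hne : (j : ℕ) ≠ d := fun hh => hjr (Fin.ext hh)
      exact ⟨fun h => by omega, fun _ => YBd _ (in4 j hjr hjU)⟩
    · have := hHU j hj hjU
      refine ⟨fun _ => ?_, fun h => by omega⟩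
      rw [out4 j hjU]; exact (hinv j hj).1 this

lemma sort_all {w x : V} {α β : ℕ → V} (hk : Hav G k w x α β)
    {q : Fin k → V} (hq : Function.Injective q) (m : ℕ) (hm : m ≤ k) :
    ∃ q', Reach G q q' (m * (6 * k ^ 2 + 2 * k + 2)) ∧
      (∀ j, q j ∉ Reg k w x α β k → q' j = q j) ∧
      ∀ j : Fin k, q j ∈ Reg k w x α β k →
      (k - m ≤ j → q' j = α (j + 1)) ∧ ((j : ℕ) < k - m → q' j ∈ Reg k w x α β (k - m)) := by
  induction m with
  | zero =>
    refine ⟨q, .refl _ _, fun _ _ => rfl, fun j hj => ⟨fun h => ?_, fun _ => ?_⟩⟩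
    · have := j.2; omega
    · simpa using hj
  | succ m ih =>
    obtain ⟨q1, h1, h2, h3⟩ := ih (by omega)
    have hin : ∀ j, q1 j ∈ Reg k w x α β k ↔ q j ∈ Reg k w x α β k := by
      intro j
      constructor
      · intro h
        by_contra hj
        rw [h2 j hj] at h; exact hj h
      · intro hj
        rw [mem_Reg hk]
        rcases Nat.lt_or_ge (j : ℕ) (k - m) with h | h
        · have := (h3 j hj).2 h
          rw [mem_Reg hk] at this
          rcases this with ⟨p, hp, h⟩ | hv
          · exact Or.inl ⟨p, by omega, h⟩
          · exact Or.inr hv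
        · have := (h3 j hj).1 h
          exact Or.inl ⟨j + 1, by have := j.2; omega, this.symm⟩
    have e : k - (m + 1) + 1 = k - m := by omega
    obtain ⟨q2, g1, g2, g3⟩ := sort_step hk (k - (m + 1)) (by omega) (h1.inj hq) (by
      intro j hj
      rw [e]
      exact h3 j ((hin j).1 hj))
    refine ⟨q2, (h1.trans g1).mono (by rw [Nat.succ_mul m]), ?_, ?_⟩
    · intro j hj
      rw [g2 j (fun h => hj ((hin j).1 h)), h2 j hj]
    · intro j hj
      exact g3 j ((hin j).2 hj)

lemma haven_jump {w x : V} {α β : ℕ → V} (hk : Hav G k w x α β)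
    {a b : Fin k → V} (ha : Function.Injective a) (hb : Function.Injective b)
    (hab : ∀ j, (a j ∈ Reg k w x α β k ∧ b j ∈ Reg k w x α β k) ∨
      (a j ∉ Reg k w x α β k ∧ b j = a j)) :
    Reach G a b (20 * k ^ 3) := by
  obtain ⟨a', ha1, ha2, ha3⟩ := sort_all hk ha k le_rfl
  obtain ⟨b', hb1, hb2, hb3⟩ := sort_all hk hb k le_rfl
  have : a' = b' := by
    funext j
    rcases hab j with ⟨h1, h2⟩ | ⟨h1, h2⟩
    · rw [(ha3 j h1).1 (by omega), (hb3 j h2).1 (by omega)]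
    · rw [ha2 j h1, hb2 j (by rw [h2]; exact h1), h2]
  subst this
  refine (ha1.trans hb1.symm).mono ?_
  rcases Nat.eq_zero_or_pos k with rfl | hpos
  · simp
  · have h1 : 1 ≤ k := hpos
    have h2 : k ≤ k ^ 2 := by nlinarith
    have : 6 * k ^ 2 + 2 * k + 2 ≤ 10 * k ^ 2 := by nlinarith
    nlinarith [Nat.mul_le_mul_left k this]

end haven

/-! ## Using a haven as a parking lot -/

def Same {V : Type} {k : ℕ} (H : Set V) (r : Fin k) (q q' : Fin k → V) : Prop :=
  ∀ j, j ≠ r → (q j ∈ H ∧ q' j ∈ H) ∨ (q j ∉ H ∧ q' j = q j)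

def JumpK {V : Type} (G : SimpleGraph V) (k : ℕ) (H : Set V) (K : ℕ) : Prop :=
  ∀ a b : Fin k → V, Function.Injective a → Function.Injective b →
    (∀ j, (a j ∈ H ∧ b j ∈ H) ∨ (a j ∉ H ∧ b j = a j)) → Reach G a b K

section parking
variable {V : Type} {G : SimpleGraph V} {k : ℕ}

lemma place {H : Set V} (hfin : H.Finite) (P : Fin k → Prop) [DecidablePred P] (F : Finset V)
    (hc : (Finset.univ.filter P).card + F.card ≤ H.ncard) (f : Fin k → V)
    (hf : Function.Injective f) (hfF : ∀ j, ¬ P j → f j ∈ F) :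
    ∃ g : Fin k → V, Function.Injective g ∧ (∀ j, ¬ P j → g j = f j) ∧
      ∀ j, P j → g j ∈ H ∧ g j ∉ F := by
  classical
  have h1 : Fintype.card {j // P j} ≤ Fintype.card {v // v ∈ hfin.toFinset \ F} := by
    rw [Fintype.card_of_subtype (Finset.univ.filter P) (by simp), Fintype.card_coe]
    have := Finset.le_card_sdiff F hfin.toFinset
    rw [Set.ncard_eq_toFinset_card _ hfin] at hc
    omega
  obtain ⟨e⟩ := Function.Embedding.nonempty_of_card_le h1
  have he : ∀ j, (e j : V) ∈ H ∧ (e j : V) ∉ F := by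
    intro j
    have := (e j).2
    rwa [Finset.mem_sdiff, hfin.mem_toFinset] at this
  refine ⟨fun j => if h : P j then e ⟨j, h⟩ else f j, ?_, ?_, ?_⟩
  · intro a b hab
    by_cases ha : P a <;> by_cases hb : P b <;> simp only [ha, hb, dite_true, dite_false] at hab
    · have := e.injective (Subtype.ext hab)
      simpa using this
    · exact absurd (hfF b hb) (hab ▸ (he _).2)
    · exact absurd (hfF a ha) (hab ▸ (he _).2)
    · exact hf hab
  · intro j hj; simp [hj]
  · intro j hj; simp only [hj, dite_true]; exact he _

lemma enter0 {H : Set V} {K : ℕ} (hfin : H.Finite) (hcard : 2 * k ≤ H.ncard)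
    (hJ : JumpK G k H K) {v w : V} (p : G.Walk v w) : w ∈ H → ∀ {q : Fin k → V}
    (_ : Function.Injective q) {r : Fin k} (_ : q r = v)
    (_ : ∀ u ∈ p.support, u ∉ H → ∀ j, j ≠ r → q j ≠ u),
    ∃ q', Reach G q q' (p.length + K) ∧ q' r ∈ H ∧ Same H r q q' := by
  have same_refl : ∀ (q : Fin k → V) r, Same H r q q := by
    intro q r j _
    by_cases h : q j ∈ H
    · exact Or.inl ⟨h, h⟩
    · exact Or.inr ⟨h, rfl⟩
  induction p with
  | nil => intro hw q hq r hr _; exact ⟨q, .refl _ _, by rw [hr]; exact hw, same_refl _ _⟩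
  | @cons v u w h p ih =>
    intro hw q hq r hr hs
    by_cases hvH : v ∈ H
    · exact ⟨q, .refl _ _, by rw [hr]; exact hvH, same_refl _ _⟩
    by_cases huH : u ∈ H
    · classical
      have hpos : 1 ≤ k := by have := r.2; omega
      obtain ⟨g, g1, g2, g3⟩ := place hfin (fun j => q j ∈ H)
        (insert u ((Finset.univ.filter (fun j => ¬ q j ∈ H)).image q)) (by
          have e1 := Finset.card_insert_le u ((Finset.univ.filter (fun j => ¬ q j ∈ H)).image q)
          have e2 := Finset.card_image_le (s := Finset.univ.filter (fun j => ¬ q j ∈ H)) (f := q)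
          have e3 := Finset.card_filter_add_card_filter_not (s := (Finset.univ : Finset (Fin k)))
            (fun j => q j ∈ H)
          simp only [Finset.card_univ, Fintype.card_fin] at e3
          omega) q hq (by
          intro j hj
          apply Finset.mem_insert_of_mem
          exact Finset.mem_image_of_mem _ (by simpa using hj))
      have j1 : Reach G q g K := hJ q g hq g1 (by
        intro j
        by_cases h : q j ∈ H
        · exact Or.inl ⟨h, (g3 j h).1⟩
        · exact Or.inr ⟨h, g2 j h⟩)
      have gr : g r = v := by rw [g2 r (by rw [hr]; exact hvH), hr]
      have m1 := Reach.move g1 (r := r) (u := u) (by rw [gr]; exact h) (by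
        intro j hj
        by_cases hjH : q j ∈ H
        · exact (g3 j hjH).2 (by simp [hj])
        · rw [g2 j hjH] at hj
          exact hjH (hj ▸ huH))
      refine ⟨_, (j1.trans m1).mono (by rw [SimpleGraph.Walk.length_cons]; omega), by simpa using huH, ?_⟩
      intro j hj
      simp only [ne_eq, hj, not_false_eq_true, Function.update_of_ne]
      by_cases h : q j ∈ H
      · exact Or.inl ⟨h, (g3 j h).1⟩
      · exact Or.inr ⟨h, g2 j h⟩
    · have m1 := Reach.move hq (r := r) (u := u) (by rw [hr]; exact h) (by
        intro j
        by_cases hj : j = r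
        · subst hj; rw [hr]; exact h.ne
        · exact hs u (by simp) huH j hj)
      obtain ⟨q', c1, c2, c3⟩ := ih hw (m1.inj hq) (r := r) (by simp) (by
        intro z hz hzH j hj
        simp only [ne_eq, hj, not_false_eq_true, Function.update_of_ne]
        exact hs z (by simp [hz]) hzH j hj)
      refine ⟨q', (m1.trans c1).mono (by simp; omega), c2, ?_⟩
      intro j hj
      simpa only [ne_eq, hj, not_false_eq_true, Function.update_of_ne] using c3 j hj

lemma last_on_walk {v w : V} (p : G.Walk v w) (Q : V → Prop) : (∃ u ∈ p.support, Q u) →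
    ∃ v' ∈ p.support, Q v' ∧ ∃ p' : G.Walk v' w, p'.length ≤ p.length ∧
      ∀ u ∈ p'.support, Q u → u = v' := by
  induction p with
  | @nil a =>
    rintro ⟨u, hu, hQ⟩
    simp at hu; subst hu
    exact ⟨u, by simp, hQ, .nil, by simp, by simp⟩
  | @cons a b c h p ih =>
    rintro ⟨u, hu, hQ⟩
    by_cases hp : ∃ u ∈ p.support, Q u
    · obtain ⟨v', h1, h2, p', h3, h4⟩ := ih hp
      exact ⟨v', by simp [h1], h2, p', by simp; omega, h4⟩
    · push Not at hp
      have hua : u = a := by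
        simp at hu
        rcases hu with hu | hu
        · exact hu
        · exact absurd hQ (hp u hu)
      subst hua
      refine ⟨u, by simp, hQ, .cons h p, le_rfl, ?_⟩
      intro z hz hzQ
      simp at hz
      rcases hz with hz | hz
      · exact hz
      · exact absurd hzQ (hp z hz)

lemma enter {H : Set V} {K : ℕ} (hfin : H.Finite) (hcard : 2 * k ≤ H.ncard)
    (hJ : JumpK G k H K) {v w : V} (hw : w ∈ H) (p : G.Walk v w) (n : ℕ) : ∀ {q : Fin k → V}
    (_ : Function.Injective q) {r : Fin k} (_ : q r ∈ p.support)
    (_ : {j | q j ∈ p.support ∧ q j ∉ H}.ncard ≤ n),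
    ∃ q', Reach G q q' (n * (2 * p.length + 3 * K)) ∧ q' r ∈ H ∧ Same H r q q' := by
  have same_refl : ∀ (q : Fin k → V) r, Same H r q q := by
    intro q r j _
    by_cases h : q j ∈ H
    · exact Or.inl ⟨h, h⟩
    · exact Or.inr ⟨h, rfl⟩
  induction n with
  | zero =>
    intro q hq r hr hc
    have h0 : {j | q j ∈ p.support ∧ q j ∉ H} = ∅ := by
      rw [← Set.ncard_eq_zero (Set.toFinite _)]; omega
    refine ⟨q, .refl _ _, ?_, same_refl _ _⟩
    by_contra hrH
    have : r ∈ {j | q j ∈ p.support ∧ q j ∉ H} := ⟨hr, hrH⟩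
    rw [h0] at this; exact this
  | succ n ih =>
    intro q hq r hr hc
    by_cases hrH : q r ∈ H
    · exact ⟨q, .refl _ _, hrH, same_refl _ _⟩
    obtain ⟨v', hv', ⟨hv'H, r', hr'⟩, p', hp', hlast⟩ :=
      last_on_walk p (fun u => u ∉ H ∧ ∃ j, q j = u) ⟨q r, hr, hrH, r, rfl⟩
    obtain ⟨q1, a1, a2, a3⟩ := enter0 hfin hcard hJ p' hw hq hr' (by
      intro u hu huH j hj hju
      have := hlast u hu ⟨huH, j, hju⟩
      exact hj (hq (hju.trans (this.trans hr'.symm))))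
    by_cases hrr : r = r'
    · subst hrr
      exact ⟨q1, a1.mono (by nlinarith), a2, a3⟩
    have hq1 := a1.inj hq
    have q1r : q1 r = q r := by
      rcases a3 r hrr with h | h
      · exact absurd h.1 hrH
      · exact h.2
    obtain ⟨q2, b1, b2, b3⟩ := ih hq1 (r := r) (by rw [q1r]; exact hr) (by
      have hsub : {j | q1 j ∈ p.support ∧ q1 j ∉ H} ⊆ {j | q j ∈ p.support ∧ q j ∉ H} \ {r'} := by
        rintro j ⟨hj1, hj2⟩
        have hjr : j ≠ r' := by rintro rfl; exact hj2 a2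
        rcases a3 j hjr with h | h
        · exact absurd h.2 hj2
        · rw [h.2] at hj1
          exact ⟨⟨hj1, h.1⟩, hjr⟩
      have e1 := Set.ncard_le_ncard hsub (Set.toFinite _)
      have e2 := Set.ncard_sdiff_singleton_add_one
        (show r' ∈ {j | q j ∈ p.support ∧ q j ∉ H} from
          ⟨by rw [hr']; exact hv', by rw [hr']; exact hv'H⟩) (Set.toFinite _)
      omega)
    have hq2 := b1.inj hq1
    have q2r' : q2 r' ∈ H := by
      rcases b3 r' (Ne.symm hrr) with h | h
      · exact h.2
      · exact absurd a2 h.1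
    -- all the other robots
    have oth : ∀ j, j ≠ r → j ≠ r' → (q j ∈ H ∧ q2 j ∈ H) ∨ (q j ∉ H ∧ q2 j = q j) := by
      intro j h1 h2
      rcases a3 j h2 with h | h
      · rcases b3 j h1 with h' | h'
        · exact Or.inl ⟨h.1, h'.2⟩
        · exact absurd h.2 h'.1
      · rcases b3 j h1 with h' | h'
        · exact absurd (h.2 ▸ h'.1) h.1
        · exact Or.inr ⟨h.1, h'.2.trans h.2⟩
    have oth' : ∀ j, j ≠ r' → q2 j ∉ H → q2 j = q j := by
      intro j h1 h2
      have hjr : j ≠ r := by rintro rfl; exact h2 b2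
      rcases oth j hjr h1 with h | h
      · exact absurd h.2 h2
      · exact h.2
    have hq3 : Function.Injective (Function.update q2 r' v') := update_inj hq2 (by
      intro j hj hjv
      have := oth' j hj (by rw [hjv]; exact hv'H)
      exact hj (hq (this.symm.trans (hjv.trans hr'.symm))))
    obtain ⟨q4, c1, c2, c3⟩ := enter0 hfin hcard hJ p' hw hq3 (r := r') (by simp) (by
      intro u hu huH j hj hju
      simp only [ne_eq, hj, not_false_eq_true, Function.update_of_ne] at hju
      have e := oth' j hj (by rw [hju]; exact huH)
      have := hlast u hu ⟨huH, j, e.symm.trans hju⟩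
      exact hj (hq (e.symm.trans (hju.trans (this.trans hr'.symm)))))
    have j24 : Reach G q2 q4 K := hJ q2 q4 hq2 (c1.inj hq3) (by
      intro j
      by_cases hj : j = r'
      · subst hj; exact Or.inl ⟨q2r', c2⟩
      · have := c3 j hj
        simpa only [ne_eq, hj, not_false_eq_true, Function.update_of_ne] using this)
    refine ⟨_, (((a1.trans b1).trans j24).trans c1.symm).mono ?_, ?_, ?_⟩
    · rw [Nat.succ_mul n]; omega
    · simpa only [ne_eq, hrr, not_false_eq_true, Function.update_of_ne] using b2
    · intro j hj
      by_cases hj' : j = r'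
      · subst hj'
        right
        simp [hr', hv'H]
      · simpa only [ne_eq, hj', not_false_eq_true, Function.update_of_ne] using oth j hj hj'

end parking

/-! ## Compressing a schedule: between first and last visit, robots stay parked -/

section compress
variable {V : Type} {G : SimpleGraph V} {k : ℕ} {I : Inst V G k}

def InP (S : Sched I) (H : Set V) (i : Fin k) (t : ℕ) (j : Fin k) : Prop :=
  j = i ∨ ((∃ s, s ≤ t ∧ S.pos s j ∈ H) ∧ ∃ s, t ≤ s ∧ s ≤ S.T ∧ S.pos s j ∈ H)

open Classical in
lemma routeLength_eq (S : Sched I) (j : Fin k) : routeLength S j =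
    ∑ s ∈ Finset.range S.T, if S.pos s j ≠ S.pos (s + 1) j then 1 else 0 := by
  unfold routeLength
  rw [← Finset.card_filter, ← Set.ncard_coe_finset]
  congr 1
  ext s
  simp

open Classical in
lemma changes_le (S : Sched I) (H : Set V) (i j : Fin k) :
    (∑ s ∈ Finset.range S.T, if ¬ (InP S H i s j ↔ InP S H i (s + 1) j) then 1 else 0) ≤ 2 := by
  have h1 : (∑ s ∈ Finset.range S.T,
      if (InP S H i s j ∧ ¬ InP S H i (s + 1) j) then 1 else 0) ≤ 1 := by
    rw [← Finset.card_filter, Finset.card_le_one]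
    have key : ∀ a b, a < b → a < S.T → b < S.T → InP S H i a j → ¬ InP S H i (a+1) j →
        InP S H i b j → False := by
      intro a b hab ha hb h1 h2 h3
      rcases h1 with h1 | ⟨⟨s, hs, hsH⟩, _⟩
      · exact h2 (Or.inl h1)
      rcases h3 with h3 | ⟨_, ⟨s', hs', hsT, hsH'⟩⟩
      · exact h2 (Or.inl h3)
      exact h2 (Or.inr ⟨⟨s, by omega, hsH⟩, ⟨s', by omega, hsT, hsH'⟩⟩)
    intro a ha b hb
    simp only [Finset.mem_filter, Finset.mem_range] at ha hb
    rcases lt_trichotomy a b with h | h | h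
    · exact (key a b h ha.1 hb.1 ha.2.1 ha.2.2 hb.2.1).elim
    · exact h
    · exact (key b a h hb.1 ha.1 hb.2.1 hb.2.2 ha.2.1).elim
  have h2 : (∑ s ∈ Finset.range S.T,
      if (¬ InP S H i s j ∧ InP S H i (s + 1) j) then 1 else 0) ≤ 1 := by
    rw [← Finset.card_filter, Finset.card_le_one]
    have key : ∀ a b, a < b → a < S.T → b < S.T → InP S H i (a+1) j → ¬ InP S H i b j →
        InP S H i (b+1) j → False := by
      intro a b hab ha hb h1 h2 h3
      rcases h1 with h1 | ⟨⟨s, hs, hsH⟩, _⟩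
      · exact h2 (Or.inl h1)
      rcases h3 with h3 | ⟨_, ⟨s', hs', hsT, hsH'⟩⟩
      · exact h2 (Or.inl h3)
      exact h2 (Or.inr ⟨⟨s, by omega, hsH⟩, ⟨s', by omega, hsT, hsH'⟩⟩)
    intro a ha b hb
    simp only [Finset.mem_filter, Finset.mem_range] at ha hb
    rcases lt_trichotomy a b with h | h | h
    · exact (key a b h ha.1 hb.1 ha.2.2 hb.2.1 hb.2.2).elim
    · exact h
    · exact (key b a h hb.1 ha.1 hb.2.2 ha.2.1 ha.2.2).elim
  refine le_trans ?_ (Nat.add_le_add h1 h2)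
  rw [← Finset.sum_add_distrib]
  refine Finset.sum_le_sum fun s _ => ?_
  by_cases ha : InP S H i s j <;> by_cases hb : InP S H i (s+1) j <;> simp [ha, hb]

def Compat (S : Sched I) (H : Set V) (i : Fin k) (t : ℕ) (q : Fin k → V) : Prop :=
  Function.Injective q ∧ ∀ j, (InP S H i t j → q j ∈ H) ∧ (¬ InP S H i t j → q j = S.pos t j)

lemma not_InP {S : Sched I} {H : Set V} {i : Fin k} {t : ℕ} (ht : t ≤ S.T) {j : Fin k}
    (h : ¬ InP S H i t j) : S.pos t j ∉ H :=
  fun hh => h (Or.inr ⟨⟨t, le_rfl, hh⟩, ⟨t, le_rfl, ht, hh⟩⟩)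

open Classical in
lemma compress_step (S : Sched I) {H : Set V} {K : ℕ} (hfin : H.Finite)
    (hcard : 2 * k ≤ H.ncard) (hJ : JumpK G k H K) (i : Fin k) (t : ℕ) (ht : t < S.T)
    {q : Fin k → V} (hq : Compat S H i t q) :
    ∃ q', Compat S H i (t + 1) q' ∧ Reach G q q'
      ((∑ j ∈ Finset.univ.erase i, if S.pos t j ≠ S.pos (t + 1) j then 1 else 0) +
        K * ∑ j, if ¬ (InP S H i t j ↔ InP S H i (t + 1) j) then 1 else 0) := by
  obtain ⟨hqi, hqc⟩ := hq
  set E : Fin k → Prop := fun j => InP S H i t j ∧ InP S H i (t + 1) j with hE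
  have it := S.noVertexConflict t ht.le
  have it1 := S.noVertexConflict (t+1) ht
  have hleave : ∀ j, InP S H i t j → ¬ InP S H i (t + 1) j → S.pos t j ∈ H := by
    intro j h1 h2
    rcases h1 with h1 | ⟨⟨s, hs, hsH⟩, ⟨s', hs', hsT, hsH'⟩⟩
    · exact absurd (Or.inl h1) h2
    rcases Nat.eq_or_lt_of_le hs' with h | h
    · rw [h]; exact hsH'
    · exact absurd (Or.inr ⟨⟨s, by omega, hsH⟩, ⟨s', h, hsT, hsH'⟩⟩) h2
  have henter : ∀ j, ¬ InP S H i t j → InP S H i (t + 1) j → S.pos (t+1) j ∈ H := by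
    intro j h2 h1
    rcases h1 with h1 | ⟨⟨s, hs, hsH⟩, ⟨s', hs', hsT, hsH'⟩⟩
    · exact absurd (Or.inl h1) h2
    rcases Nat.eq_or_lt_of_le hs with h | h
    · rw [← h]; exact hsH
    · exact absurd (Or.inr ⟨⟨s, by omega, hsH⟩, ⟨s', by omega, hsT, hsH'⟩⟩) h2
  have hiE : E i := ⟨Or.inl rfl, Or.inl rfl⟩
  obtain ⟨g, hg1, hg2, hg3, hg4⟩ : ∃ g : Fin k → V, Function.Injective g ∧
      (∀ j, ¬ E j → g j = S.pos t j) ∧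
      (∀ j, E j → g j ∈ H ∧ ∀ j', ¬ E j' → g j ≠ S.pos (t+1) j') ∧
      Reach G q g (K * ∑ j, if ¬ (InP S H i t j ↔ InP S H i (t + 1) j) then 1 else 0) := by
    by_cases hev : ∀ j, (InP S H i t j ↔ InP S H i (t + 1) j)
    · refine ⟨q, hqi, ?_, ?_, .refl _ _⟩
      · intro j hj
        exact (hqc j).2 (fun h => hj ⟨h, (hev j).1 h⟩)
      · intro j hj
        refine ⟨(hqc j).1 hj.1, fun j' hj' hh => ?_⟩
        have : ¬ InP S H i (t+1) j' := fun h => hj' ⟨(hev j').2 h, h⟩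
        exact not_InP ht this (hh ▸ (hqc j).1 hj.1)
    · push Not at hev
      obtain ⟨j0, hj0⟩ := hev
      obtain ⟨g, g1, g2, g3⟩ := place hfin E
        ((Finset.univ.filter (fun j => ¬ E j)).image (S.pos t) ∪
          (Finset.univ.filter (fun j => ¬ E j)).image (S.pos (t+1))) (by
          have e1 := Finset.card_union_le
            ((Finset.univ.filter (fun j => ¬ E j)).image (S.pos t))
            ((Finset.univ.filter (fun j => ¬ E j)).image (S.pos (t+1)))
          have e2 := Finset.card_image_le (s := Finset.univ.filter (fun j => ¬ E j))
            (f := S.pos t)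
          have e2' := Finset.card_image_le (s := Finset.univ.filter (fun j => ¬ E j))
            (f := S.pos (t+1))
          have e3 := Finset.card_filter_add_card_filter_not (s := (Finset.univ : Finset (Fin k))) E
          simp only [Finset.card_univ, Fintype.card_fin] at e3
          omega) (S.pos t) it (by
          intro j hj
          apply Finset.mem_union_left
          exact Finset.mem_image_of_mem _ (by simpa using hj))
      refine ⟨g, g1, g2, ?_, ?_⟩
      · intro j hj
        refine ⟨(g3 j hj).1, fun j' hj' hh => (g3 j hj).2 ?_⟩
        apply Finset.mem_union_right
        rw [hh]
        exact Finset.mem_image_of_mem _ (by simpa using hj')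
      · refine (hJ q g hqi g1 ?_).mono ?_
        · intro j
          by_cases hj : InP S H i t j
          · left
            refine ⟨(hqc j).1 hj, ?_⟩
            by_cases hj1 : InP S H i (t+1) j
            · exact (g3 j ⟨hj, hj1⟩).1
            · rw [g2 j (fun h => hj1 h.2)]
              exact hleave j hj hj1
          · right
            rw [(hqc j).2 hj]
            exact ⟨not_InP ht.le hj, g2 j (fun h => hj h.1)⟩
        · refine Nat.le_mul_of_pos_right K ?_
          refine Finset.sum_pos' (fun _ _ => Nat.zero_le _) ⟨j0, Finset.mem_univ _, ?_⟩
          have : ¬ (InP S H i t j0 ↔ InP S H i (t + 1) j0) := by tauto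
          simp [this]
  set q' : Fin k → V := fun j => if E j then g j else S.pos (t+1) j with hq'
  have q'E : ∀ j, E j → q' j = g j := by intro j hj; simp [hq', hj]
  have q'N : ∀ j, ¬ E j → q' j = S.pos (t+1) j := by intro j hj; simp [hq', hj]
  have hinj' : Function.Injective q' := by
    intro a b hab
    by_cases ha : E a <;> by_cases hb : E b
    · rw [q'E a ha, q'E b hb] at hab; exact hg1 hab
    · rw [q'E a ha, q'N b hb] at hab; exact absurd hab ((hg3 a ha).2 b hb)
    · rw [q'N a ha, q'E b hb] at hab; exact absurd hab.symm ((hg3 b hb).2 a ha)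
    · rw [q'N a ha, q'N b hb] at hab; exact it1 hab
  have hstep : CStep G g q' := by
    refine ⟨hg1, hinj', ?_, ?_⟩
    · intro j
      by_cases hj : E j
      · exact Or.inl (q'E j hj)
      · rw [q'N j hj, hg2 j hj]
        exact S.step t ht j
    · rintro a b hab ⟨h1, h2⟩
      by_cases ha : E a
      · rw [q'E a ha] at h1; exact hab (hg1 h1)
      by_cases hb : E b
      · rw [q'E b hb] at h2; exact hab (hg1 h2).symm
      rw [q'N a ha, hg2 b hb] at h1
      rw [q'N b hb, hg2 a ha] at h2
      exact S.noSwap t ht a b hab ⟨h1, h2⟩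
  refine ⟨q', ⟨hinj', ?_⟩, .tail hg4 hstep ?_⟩
  · intro j
    constructor
    · intro hj
      by_cases hj0 : InP S H i t j
      · rw [q'E j ⟨hj0, hj⟩]; exact (hg3 j ⟨hj0, hj⟩).1
      · rw [q'N j (fun h => hj0 h.1)]; exact henter j hj0 hj
    · intro hj
      exact q'N j (fun h => hj h.2)
  · rw [add_comm]
    refine Nat.add_le_add_right ?_ _
    unfold mv
    rw [← Finset.add_sum_erase _ _ (Finset.mem_univ i)]
    rw [q'E i hiE]
    simp only [ne_eq, not_true_eq_false, if_false, zero_add]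
    refine Finset.sum_le_sum fun j _ => ?_
    by_cases hj : E j
    · rw [q'E j hj]; simp
    · rw [q'N j hj, hg2 j hj]

open Classical in
lemma compress_upto (S : Sched I) {H : Set V} {K : ℕ} (hfin : H.Finite)
    (hcard : 2 * k ≤ H.ncard) (hJ : JumpK G k H K) (i : Fin k)
    {q : Fin k → V} (hq : Compat S H i 0 q) (t : ℕ) (ht : t ≤ S.T) :
    ∃ q', Compat S H i t q' ∧ Reach G q q'
      (∑ s ∈ Finset.range t, 
        ((∑ j ∈ Finset.univ.erase i, if S.pos s j ≠ S.pos (s + 1) j then 1 else 0) +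
        K * ∑ j, if ¬ (InP S H i s j ↔ InP S H i (s + 1) j) then 1 else 0)) := by
  induction t with
  | zero => exact ⟨q, hq, .refl _ _⟩
  | succ t ih =>
    obtain ⟨q1, h1, h2⟩ := ih (by omega)
    obtain ⟨q2, h3, h4⟩ := compress_step S hfin hcard hJ i t (by omega) h1
    refine ⟨q2, h3, ?_⟩
    rw [Finset.sum_range_succ]
    exact h2.trans h4

lemma compress (S : Sched I) {H : Set V} {K : ℕ} (hfin : H.Finite)
    (hcard : 2 * k ≤ H.ncard) (hJ : JumpK G k H K) (i : Fin k)
    {q : Fin k → V} (hq : Function.Injective q) (hqi : q i ∈ H) (hs : Same H i (S.pos 0) q) :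
    ∃ q', Reach G q q' ((∑ j ∈ Finset.univ.erase i, routeLength S j) + (2 * k + 1) * K) ∧
      ∀ j, j ≠ i → q' j = S.pos S.T j := by
  classical
  have hc0 : Compat S H i 0 q := by
    refine ⟨hq, fun j => ⟨fun h => ?_, fun h => ?_⟩⟩
    · by_cases hj : j = i
      · rw [hj]; exact hqi
      rcases h with h | ⟨⟨s, hs0, hsH⟩, _⟩
      · exact absurd h hj
      · have : s = 0 := by omega
        subst this
        rcases hs j hj with h | h
        · exact h.2
        · exact absurd hsH h.1
    · have hj : j ≠ i := fun hh => h (Or.inl hh)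
      rcases hs j hj with h' | h'
      · exact absurd h'.1 (not_InP (Nat.zero_le _) h)
      · exact h'.2
  obtain ⟨q1, ⟨c1, c2⟩, h2⟩ := compress_upto S hfin hcard hJ i hc0 S.T le_rfl
  have hpos : 1 ≤ k := by have := i.2; omega
  obtain ⟨g, g1, g2, g3⟩ := place hfin (fun j => j = i)
    ((Finset.univ.filter (fun j => ¬ j = i)).image (S.pos S.T)) (by
      have e2 := Finset.card_image_le (s := Finset.univ.filter (fun j : Fin k => ¬ j = i))
        (f := S.pos S.T)
      have e3 := Finset.card_filter_add_card_filter_not (s := (Finset.univ : Finset (Fin k)))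
        (fun j => j = i)
      simp only [Finset.card_univ, Fintype.card_fin] at e3
      omega) (S.pos S.T) (S.noVertexConflict _ le_rfl) (by
      intro j hj
      exact Finset.mem_image_of_mem _ (by simpa using hj))
  have h3 : Reach G q1 g K := hJ q1 g c1 g1 (by
    intro j
    by_cases hj : InP S H i S.T j
    · left
      refine ⟨(c2 j).1 hj, ?_⟩
      by_cases hji : j = i
      · exact (g3 j hji).1
      · rw [g2 j hji]
        rcases hj with h | ⟨_, ⟨s, hs1, hs2, hsH⟩⟩
        · exact absurd h hji
        · have : s = S.T := by omega
          rw [← this]; exact hsH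
    · right
      rw [(c2 j).2 hj]
      exact ⟨not_InP le_rfl hj, g2 j (fun h => hj (Or.inl h))⟩)
  refine ⟨g, (h2.trans h3).mono ?_, g2⟩
  rw [Finset.sum_add_distrib, Finset.sum_comm, ← Finset.mul_sum]
  have e1 : ∑ s ∈ Finset.range S.T, ∑ j, (if ¬ (InP S H i s j ↔ InP S H i (s + 1) j)
      then 1 else 0) ≤ 2 * k := by
    rw [Finset.sum_comm]
    refine (Finset.sum_le_sum fun j _ => changes_le S H i j).trans ?_
    simp [mul_comm]
  simp only [← routeLength_eq]
  nlinarith [Nat.mul_le_mul_left K e1]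

end compress

/-! ## Assembling -/

section assemble
variable {V : Type} {G : SimpleGraph V} {k : ℕ}

lemma exists_chain (C : G.Subgraph) (hC : C.Connected) {w : V} (hw : w ∈ C.verts) (m : ℕ)
    (hm : m + 1 ≤ C.verts.ncard) : ∃ α : ℕ → V, α 0 = w ∧ (∀ p ≤ m, α p ∈ C.verts) ∧
      (∀ p, 1 ≤ p → p ≤ m → ∃ q < p, G.Adj (α q) (α p)) ∧
      (∀ p q, p ≤ m → q ≤ m → α p = α q → p = q) := by
  classical
  induction m with
  | zero =>
    refine ⟨fun _ => w, rfl, fun _ _ => hw, fun p h1 h2 => by omega, fun p q h1 h2 _ => by omega⟩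
  | succ m ih =>
    obtain ⟨α, h0, h1, h2, h3⟩ := ih (by omega)
    have hz : ∃ z ∈ C.verts, z ∉ α '' Set.Iic m := by
      by_contra hcon
      push Not at hcon
      have e1 := Set.ncard_le_ncard (s := C.verts) (t := α '' Set.Iic m) hcon
        ((Set.finite_Iic m).image α)
      have e2 := Set.ncard_image_le (f := α) (Set.finite_Iic m)
      have e3 : (Set.Iic m).ncard = m + 1 := by
        rw [← Finset.coe_Iic, Set.ncard_coe_finset]; simp
      omega
    obtain ⟨z, hzC, hz⟩ := hz
    obtain ⟨W⟩ := hC.coe.preconnected ⟨w, hw⟩ ⟨z, hzC⟩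
    obtain ⟨d, -, hd1, hd2⟩ := W.exists_boundary_dart {v | (v : V) ∈ α '' Set.Iic m}
      (by exact ⟨0, by simp, h0⟩) hz
    obtain ⟨s, hs, hsd⟩ := hd1
    simp at hs
    have hadj : G.Adj (d.fst : V) (d.snd : V) := C.adj_sub d.adj
    have hn : ∀ p ≤ m, α p ≠ (d.snd : V) := fun p hp hh => hd2 ⟨p, by simpa using hp, hh⟩
    refine ⟨fun p => if p ≤ m then α p else d.snd, by simp [h0], ?_, ?_, ?_⟩
    · intro p hp
      by_cases hpm : p ≤ m
      · simp [hpm, h1 p hpm]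
      · simp [hpm]
    · intro p hp hpm'
      by_cases hpm : p ≤ m
      · obtain ⟨q, hq, h⟩ := h2 p hp hpm
        have hqm : q ≤ m := by omega
        exact ⟨q, hq, by simpa [hpm, hqm] using h⟩
      · refine ⟨s, by omega, ?_⟩
        simp only [hs, hpm, if_true, if_false]
        rw [hsd]; exact hadj
    · intro p q hp hq hpq
      by_cases hpm : p ≤ m <;> by_cases hqm : q ≤ m <;>
        simp only [hpm, hqm, if_true, if_false] at hpq
      · exact h3 p q hpm hqm hpq
      · exact absurd hpq (hn p hpm)
      · exact absurd hpq.symm (hn q hqm)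
      · omega

lemma exists_haven {w : V} (h : IsNice G k w) : ∃ x α β, Hav G k w x α β := by
  obtain ⟨C1, C2, C3, c1, c2, c3, h12, h13, h23, n1, n2, n3⟩ := h
  have w12 : w ∈ C1.verts ∩ C2.verts := by rw [h12]; rfl
  have w13 : w ∈ C1.verts ∩ C3.verts := by rw [h13]; rfl
  obtain ⟨α, a0, a1, a2, a3⟩ := exists_chain C1 c1 w12.1 k n1
  obtain ⟨β, b0, b1, b2, b3⟩ := exists_chain C2 c2 w12.2 k n2
  obtain ⟨γ, g0, g1, g2, g3⟩ := exists_chain C3 c3 w13.2 1 n3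
  have hadj : G.Adj w (γ 1) := by
    obtain ⟨q, hq, h⟩ := g2 1 le_rfl le_rfl
    have : q = 0 := by omega
    subst this
    rwa [g0] at h
  refine ⟨γ 1, α, β, a0, b0, hadj, a2, b2, a3, b3, ?_, ?_, ?_⟩
  · intro p q hp hq hpq
    have : α p ∈ C1.verts ∩ C2.verts := ⟨a1 p hp, hpq ▸ b1 q hq⟩
    rw [h12] at this
    have e : α p = w := this
    exact ⟨a3 p 0 hp (by omega) (e.trans a0.symm),
      b3 q 0 hq (by omega) (hpq.symm.trans (e.trans b0.symm))⟩
  · intro p hp hh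
    have : α p ∈ C1.verts ∩ C3.verts := ⟨a1 p hp, hh ▸ g1 1 le_rfl⟩
    rw [h13] at this
    have e : α p = w := this
    exact hadj.ne (e.symm.trans hh)
  · intro p hp hh
    have : β p ∈ C2.verts ∩ C3.verts := ⟨b1 p hp, hh ▸ g1 1 le_rfl⟩
    rw [h23] at this
    have e : β p = w := this
    exact hadj.ne (e.symm.trans hh)

lemma Reg_finite {w x : V} {α β : ℕ → V} : (Reg k w x α β k).Finite := by
  unfold Reg
  exact (((Set.finite_Iic k).image α).union ((Set.finite_Iic k).image β)).union (Set.toFinite _)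

lemma Reg_card {w x : V} {α β : ℕ → V} (hk : Hav G k w x α β) :
    2 * k ≤ (Reg k w x α β k).ncard := by
  classical
  have hsub : (((Finset.Icc 1 k).image α ∪ (Finset.Icc 1 k).image β : Finset V) : Set V) ⊆
      Reg k w x α β k := by
    intro v hv
    rw [mem_Reg hk]
    simp only [Finset.coe_union, Finset.coe_image, Set.mem_union, Set.mem_image,
      Finset.coe_Icc, Set.mem_Icc] at hv
    rcases hv with ⟨p, hp, h⟩ | ⟨p, hp, h⟩
    · exact Or.inl ⟨p, hp.2, h⟩
    · exact Or.inr (Or.inl ⟨p, hp.2, h⟩)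
  have h1 := Set.ncard_le_ncard hsub Reg_finite
  rw [Set.ncard_coe_finset, Finset.card_union_of_disjoint, Finset.card_image_of_injOn,
    Finset.card_image_of_injOn, Nat.card_Icc] at h1
  · omega
  · intro a ha b hb hab
    simp at ha hb
    exact hk.binj a b ha.2 hb.2 hab
  · intro a ha b hb hab
    simp at ha hb
    exact hk.ainj a b ha.2 hb.2 hab
  · rw [Finset.disjoint_left]
    intro v h1 h2
    simp at h1 h2
    obtain ⟨p, hp, h⟩ := h1
    obtain ⟨q, hq, h'⟩ := h2
    have := hk.ab p q hp.2 hq.2 (h.trans h'.symm)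
    omega

lemma Reach.toSeq {a b : Fin k → V} {c : ℕ} (h : Reach G a b c) : ∃ (T : ℕ)
    (pos : ℕ → Fin k → V), pos 0 = a ∧ pos T = b ∧
    (∀ j, j < T → CStep G (pos j) (pos (j + 1))) ∧
    ∑ s ∈ Finset.range T, mv (pos s) (pos (s + 1)) ≤ c := by
  induction h with
  | refl => exact ⟨0, fun _ => a, rfl, rfl, fun j hj => by omega, by simp⟩
  | @tail b d c c' h1 h2 h3 ih =>
    obtain ⟨T, pos, p0, pT, ps, pc⟩ := ih
    have e : ∀ s, s ≤ T → (fun s => if s ≤ T then pos s else d) s = pos s := by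
      intro s hs; simp [hs]
    refine ⟨T + 1, fun s => if s ≤ T then pos s else d, by simp [p0], by simp, ?_, ?_⟩
    · intro j hj
      rcases Nat.lt_or_ge j T with h | h
      · rw [e j h.le, e (j+1) h]; exact ps j h
      · have : j = T := by omega
        subst this
        rw [e j le_rfl, pT]
        simpa using h2
    · rw [Finset.sum_range_succ]
      have : ∑ s ∈ Finset.range T, mv ((fun s => if s ≤ T then pos s else d) s)
          ((fun s => if s ≤ T then pos s else d) (s+1)) =
          ∑ s ∈ Finset.range T, mv (pos s) (pos (s + 1)) := by
        refine Finset.sum_congr rfl fun s hs => ?_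
        rw [Finset.mem_range] at hs
        rw [e s hs.le, e (s+1) hs]
      rw [this, e T le_rfl, pT]
      simp only [Nat.not_succ_le_self, if_false]
      omega

lemma Reach.toSched {I : Inst V G k} {b : Fin k → V} {c : ℕ} (h : Reach G I.start b c)
    (hb : ∀ j, I.isM j → b j = I.dest j) : ∃ S : Sched I, totalLength S ≤ c := by
  classical
  obtain ⟨T, pos, p0, pT, ps, pc⟩ := h.toSeq
  have hinj : ∀ j, j ≤ T → Function.Injective (pos j) := by
    intro j hj
    rcases Nat.eq_zero_or_pos j with rfl | hpos
    · rw [p0]; exact I.start_inj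
    · obtain ⟨j', rfl⟩ : ∃ j', j = j' + 1 := ⟨j - 1, by omega⟩
      exact (ps j' (by omega)).2.1
  refine ⟨⟨T, pos, fun i => by rw [p0], fun i hi => by rw [pT]; exact hb i hi,
    fun j hj => (ps j hj).2.2.1, hinj, fun j hj => (ps j hj).2.2.2⟩, ?_⟩
  unfold totalLength
  simp only [routeLength_eq]
  rw [Finset.sum_comm]
  refine le_trans (le_of_eq ?_) pc
  refine Finset.sum_congr rfl fun s _ => ?_
  unfold mv
  rfl

end assemble

/-- There is a universal constant `c > 0` such that: for every GCMP
instance with `k` robots and every optimal schedule `S`, every free robot `i` whose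
starting vertex is at distance `lam` from a nice vertex has traveled length at most
`c * (lam * k + k ^ 4)` in `S`. -/
theorem free_robot_length_bound :
    ∃ c : ℕ, 0 < c ∧
      ∀ (V : Type) (G : SimpleGraph V) (k : ℕ) (I : Inst V G k) (S : Sched I),
        Optimal S →
        ∀ (i : Fin k) (lam : ℕ), ¬ I.isM i →
          (∃ n : V, IsNice G k n ∧ G.Reachable (I.start i) n ∧ G.dist (I.start i) n = lam) →
          routeLength S i ≤ c * (lam * k + k ^ 4) := by
  refine ⟨120, by norm_num, ?_⟩
  rintro V G k I S hopt i lam hi ⟨n, hn, hreach, hdist⟩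
  obtain ⟨x, α, β, hk⟩ := exists_haven hn
  have hfin : (Reg k n x α β k).Finite := Reg_finite
  have hcard := Reg_card hk
  have hJ : JumpK G k (Reg k n x α β k) (20 * k ^ 3) := fun a b ha hb hab => haven_jump hk ha hb hab
  obtain ⟨p, hp⟩ := hreach.exists_walk_length_eq_dist
  have hnH : n ∈ Reg k n x α β k := by
    rw [mem_Reg hk]; exact Or.inl ⟨0, by omega, hk.a0⟩
  obtain ⟨q, r1, r2, r3⟩ := enter hfin hcard hJ hnH p k I.start_inj (r := i) (by simp) (by
    refine (Set.ncard_le_ncard (Set.subset_univ _) Set.finite_univ).trans ?_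
    simp [Set.ncard_univ])
  have h0 : S.pos 0 = I.start := funext S.init
  obtain ⟨q', r4, r5⟩ := compress S hfin hcard hJ i (r1.inj I.start_inj) r2 (by rw [h0]; exact r3)
  obtain ⟨S', hS'⟩ := (r1.trans r4).toSched (by
    intro j hj
    have hji : j ≠ i := by rintro rfl; exact hi hj
    rw [r5 j hji]; exact S.final j hj)
  have h1 := (hopt S').trans hS'
  unfold totalLength at h1
  rw [← Finset.add_sum_erase _ _ (Finset.mem_univ i), hp, hdist] at h1
  have hpos : 1 ≤ k := by have := i.2; omega
  have h2 : (2 * k + 1) * (20 * k ^ 3) ≤ 60 * k ^ 4 := by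
    calc (2 * k + 1) * (20 * k ^ 3) ≤ (3 * k) * (20 * k ^ 3) := Nat.mul_le_mul_right _ (by omega)
      _ = 60 * k ^ 4 := by ring
  have h3 : k * (2 * lam + 3 * (20 * k ^ 3)) = 2 * (lam * k) + 60 * k ^ 4 := by ring
  omega
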